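/- Let 0 < λ < 1. Then, as k → 1⁻, sn(λK(k), k) ~ 1 − 2(k'/4)^{2λ}, in the sense that (1 − sn(λK(k), k)) / (2(k'/4)^{2λ}) tends to 1 as k → 1⁻, where k' = √(1−k²). -/

import Mathlib

open Real

/-- Complete elliptic integral of the first kind. -/
noncomputable def EllK (k : ℝ) : ℝ :=
  ∫ θ in (0:ℝ)..(π/2), 1 / Real.sqrt (1 - k^2 * Real.sin θ ^ 2)

/-- Complete elliptic integral of the second kind. -/
noncomputable def EllE (k : ℝ) : ℝ :=
  ∫ θ in (0:ℝ)..(π/2), Real.sqrt (1 - k^2 * Real.sin θ ^ 2)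

/-- Complementary complete elliptic integral `K'(k) = K(√(1-k²))`. -/
noncomputable def EllK' (k : ℝ) : ℝ := EllK (Real.sqrt (1 - k^2))

/-- Complementary elliptic integral of the second kind `E'(k) = E(√(1-k²))`. -/
noncomputable def EllE' (k : ℝ) : ℝ := EllE (Real.sqrt (1 - k^2))

/-- The nome `q = exp(-π K'(k)/K(k))`. -/
noncomputable def nome (k : ℝ) : ℝ := Real.exp (-π * EllK' k / EllK k)

/-- Jacobi's theta function `Θ(u,k) = 1 + 2 ∑_{n≥1} (-1)^n q^{n²} cos(nπu/K)`. -/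
noncomputable def JTheta (u k : ℝ) : ℝ :=
  1 + 2 * ∑' n : ℕ, (-1 : ℝ)^(n+1) * nome k ^ ((n+1)^2) *
    Real.cos (((n:ℝ)+1) * π * u / EllK k)

/-- Jacobi's theta function `H(u,k) = 2 ∑_{n≥0} (-1)^n q^{(n+1/2)²} sin((2n+1)πu/(2K))`. -/
noncomputable def JH (u k : ℝ) : ℝ :=
  2 * ∑' n : ℕ, (-1 : ℝ)^n * nome k ^ ((((n:ℝ) + 1/2)^2)) *
    Real.sin ((2*(n:ℝ)+1) * π * u / (2 * EllK k))

/-- Jacobi's theta function `H₁(u,k) = 2 ∑_{n≥0} q^{(n+1/2)²} cos((2n+1)πu/(2K))`. -/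
noncomputable def JH1 (u k : ℝ) : ℝ :=
  2 * ∑' n : ℕ, nome k ^ ((((n:ℝ) + 1/2)^2)) *
    Real.cos ((2*(n:ℝ)+1) * π * u / (2 * EllK k))

/-- Jacobi's theta function `Θ₁(u,k) = 1 + 2 ∑_{n≥1} q^{n²} cos(nπu/K)`. -/
noncomputable def JTheta1 (u k : ℝ) : ℝ :=
  1 + 2 * ∑' n : ℕ, nome k ^ ((n+1)^2) * Real.cos (((n:ℝ)+1) * π * u / EllK k)

/-- Jacobi's zeta function `zn(u,k) = Θ_u(u,k)/Θ(u,k)`. -/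
noncomputable def zn (u k : ℝ) : ℝ := deriv (fun v => JTheta v k) u / JTheta u k

/-- Jacobi's elliptic sine `sn(u,k) = H(u,k)/(√k Θ(u,k))`. -/
noncomputable def sn (u k : ℝ) : ℝ := JH u k / (Real.sqrt k * JTheta u k)

/-- Jacobi's elliptic cosine `cn(u,k) = √(k'/k) H₁(u,k)/Θ(u,k)`. -/
noncomputable def cn (u k : ℝ) : ℝ :=
  Real.sqrt (Real.sqrt (1 - k^2) / k) * JH1 u k / JTheta u k

/-- Jacobi's delta amplitude `dn(u,k) = √(k') Θ₁(u,k)/Θ(u,k)`. -/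
noncomputable def dn (u k : ℝ) : ℝ :=
  Real.sqrt (Real.sqrt (1 - k^2)) * JTheta1 u k / JTheta u k

open Filter Topology HurwitzZeta

lemma hasSum_cosKernel_sub_cosKernel (a b : ℝ) {t : ℝ} (ht : 0 < t) :
    HasSum (fun n : ℕ => (cos (2 * π * a * (n + 1)) - cos (2 * π * b * (n + 1))) *
      exp (-π * (n + 1) ^ 2 * t)) ((cosKernel a t - cosKernel b t) / 2) := by
  have h := ((hasSum_nat_cosKernel₀ a ht).sub (hasSum_nat_cosKernel₀ b ht)).div_const 2
  rw [show (cosKernel a t - cosKernel b t) / 2 = (cosKernel a t - 1 - (cosKernel b t - 1)) / 2 by ring]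
  exact h.congr_fun fun n => by ring

lemma hasSum_cosKernel_add_cosKernel (a b : ℝ) {t : ℝ} (ht : 0 < t) :
    HasSum (fun n : ℕ => (cos (2 * π * a * (n + 1)) + cos (2 * π * b * (n + 1))) *
      exp (-π * (n + 1) ^ 2 * t)) ((cosKernel a t + cosKernel b t) / 2 - 1) := by
  have h := ((hasSum_nat_cosKernel₀ a ht).add (hasSum_nat_cosKernel₀ b ht)).div_const 2
  rw [show (cosKernel a t + cosKernel b t) / 2 - 1 = (cosKernel a t - 1 + (cosKernel b t - 1)) / 2 by ring]
  exact h.congr_fun fun n => by ring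

lemma hasSum_alternating_sin_theta (lam : ℝ) {t : ℝ} (ht : 0 < t) :
    HasSum (fun n : ℕ => 2 * ((-1) ^ n * exp (-π * t) ^ (((n : ℝ) + 1 / 2) ^ 2) *
        sin ((2 * (n : ℝ) + 1) * π * lam / 2)))
      ((cosKernel ((1 - lam) / 4 : ℝ) (t / 4) - cosKernel ((1 + lam) / 4 : ℝ) (t / 4)) / 2) := by
  have h := hasSum_cosKernel_sub_cosKernel ((1 - lam) / 4) ((1 + lam) / 4)
    (show 0 < t / 4 by positivity)
  have hinj : Function.Injective (fun j : ℕ => 2 * j) := fun _ _ hij => by simpa using hij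
  have hsub (n : ℕ) : cos (2 * π * ((1 - lam) / 4) * (n + 1)) -
      cos (2 * π * ((1 + lam) / 4) * (n + 1)) =
      2 * (sin ((n + 1 : ℕ) * (π / 2)) * sin ((n + 1) * π * lam / 2)) := by
    rw [show 2 * π * ((1 - lam) / 4) * (n + 1) =
        ((n + 1 : ℕ) : ℝ) * (π / 2) - (n + 1) * π * lam / 2 by push_cast; ring,
      show 2 * π * ((1 + lam) / 4) * (n + 1) =
        ((n + 1 : ℕ) : ℝ) * (π / 2) + (n + 1) * π * lam / 2 by push_cast; ring, cos_sub, cos_add]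
    ring
  rw [← hinj.hasSum_iff] at h
  · refine h.congr_fun ?_
    intro n
    simp only [Function.comp_apply, hsub]
    have hsin : sin (((2 * n + 1 : ℕ) : ℝ) * (π / 2)) = (-1) ^ n := by
      rw [show ((2 * n + 1 : ℕ) : ℝ) * (π / 2) = n * π + π / 2 by push_cast; ring, sin_add_pi_div_two,
        cos_nat_mul_pi]
    rw [hsin, ← exp_mul]
    push_cast
    rw [show -π * (2 * (n : ℝ) + 1) ^ 2 * (t / 4) = -π * t * (n + 1 / 2) ^ 2 by ring]
    ring
  · intro n hn
    obtain ⟨m, hm⟩ : ∃ m, n + 1 = 2 * m := by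
      rcases Nat.even_or_odd' n with ⟨c, hc | hc⟩
      · exact absurd ⟨c, hc.symm⟩ hn
      · exact ⟨c + 1, by omega⟩
    rw [hsub, hm, show ((2 * m : ℕ) : ℝ) * (π / 2) = m * π by push_cast; ring, sin_nat_mul_pi]
    simp

lemma hasSum_alternating_cos_theta (lam : ℝ) {t : ℝ} (ht : 0 < t) :
    HasSum (fun n : ℕ => 2 * ((-1) ^ (n + 1) * exp (-π * t) ^ ((n + 1) ^ 2) *
        cos (((n : ℝ) + 1) * π * lam)))
      ((cosKernel ((1 - lam) / 4 : ℝ) (t / 4) + cosKernel ((1 + lam) / 4 : ℝ) (t / 4)) / 2 - 1) := by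
  have h := hasSum_cosKernel_add_cosKernel ((1 - lam) / 4) ((1 + lam) / 4)
    (show 0 < t / 4 by positivity)
  have hinj : Function.Injective (fun j : ℕ => 2 * j + 1) := fun _ _ hij => by simpa using hij
  have hadd (n : ℕ) : cos (2 * π * ((1 - lam) / 4) * (n + 1)) +
      cos (2 * π * ((1 + lam) / 4) * (n + 1)) =
      2 * (cos ((n + 1 : ℕ) * (π / 2)) * cos ((n + 1) * π * lam / 2)) := by
    rw [show 2 * π * ((1 - lam) / 4) * (n + 1) =
        ((n + 1 : ℕ) : ℝ) * (π / 2) - (n + 1) * π * lam / 2 by push_cast; ring,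
      show 2 * π * ((1 + lam) / 4) * (n + 1) =
        ((n + 1 : ℕ) : ℝ) * (π / 2) + (n + 1) * π * lam / 2 by push_cast; ring, cos_sub, cos_add]
    ring
  rw [← hinj.hasSum_iff] at h
  · refine h.congr_fun ?_
    intro n
    simp only [Function.comp_apply, hadd]
    have hcos : cos (((2 * n + 1 + 1 : ℕ) : ℝ) * (π / 2)) = (-1) ^ (n + 1) := by
      rw [show ((2 * n + 1 + 1 : ℕ) : ℝ) * (π / 2) = (n + 1 : ℕ) * π by push_cast; ring,
        cos_nat_mul_pi]
    rw [hcos, ← exp_nat_mul]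
    push_cast
    rw [show -π * (2 * (n : ℝ) + 1 + 1) ^ 2 * (t / 4) = ((n : ℝ) + 1) ^ 2 * (-π * t) by ring,
      show (2 * (n : ℝ) + 1 + 1) * π * lam / 2 = (n + 1) * π * lam by ring]
    ring
  · intro n hn
    obtain ⟨m, rfl⟩ : ∃ m, n = 2 * m := by
      rcases Nat.even_or_odd' n with ⟨c, hc | hc⟩
      · exact ⟨c, hc⟩
      · exact absurd ⟨c, hc.symm⟩ hn
    rw [hadd, show ((2 * m + 1 : ℕ) : ℝ) * (π / 2) = m * π + π / 2 by push_cast; ring,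
      cos_add_pi_div_two, sin_nat_mul_pi]
    simp

lemma cosKernel_eq_evenKernel (a : UnitAddCircle) {t : ℝ} (ht : 0 < t) :
    cosKernel a (t / 4) = 2 * (1 / t) ^ (1 / 2 : ℝ) * evenKernel a (4 / t) := by
  have h4 : (4 : ℝ) ^ (1 / 2 : ℝ) = 2 := by
    rw [← sqrt_eq_rpow, show (4 : ℝ) = 2 ^ 2 by norm_num, sqrt_sq (by norm_num)]
  have hpos : 0 < (1 / t) ^ (1 / 2 : ℝ) := by positivity
  rw [evenKernel_functional_equation, one_div_div, show 4 / t = 4 * (1 / t) by ring,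
    mul_rpow (by norm_num) (by positivity), h4]
  field_simp

lemma evenKernel_pos (a : ℝ) {x : ℝ} (hx : 0 < x) : 0 < evenKernel a x := by
  have h := hasSum_int_evenKernel a hx
  rw [← h.tsum_eq]
  exact h.summable.tsum_pos (fun n => (exp_pos _).le) 0 (exp_pos _)

/-- Leading behaviour of the even Hurwitz kernel at infinity. -/
lemma tendsto_evenKernel_mul_exp {a : ℝ} (ha : |a| < 1 / 2) :
    Tendsto (fun x => evenKernel a x * exp (π * a ^ 2 * x)) atTop (𝓝 1) := by
  have hterm {x : ℝ} (hx : 0 < x) :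
      HasSum (fun n : ℤ => exp (-π * (n * (n + 2 * a)) * x))
        (evenKernel a x * exp (π * a ^ 2 * x)) := by
    refine ((hasSum_int_evenKernel a hx).mul_right _).congr_fun fun n => ?_
    rw [← exp_add]
    ring_nf
  have hgap (n : ℤ) (hn : n ≠ 0) : 0 < (n : ℝ) * (n + 2 * a) := by
    obtain ⟨h1, h2⟩ := abs_lt.mp ha
    rcases lt_or_gt_of_ne hn with h | h
    · have : (n : ℝ) ≤ -1 := by exact_mod_cast (by omega : n ≤ -1)
      nlinarith
    · have : (1 : ℝ) ≤ n := by exact_mod_cast h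
      nlinarith
  have hlim : Tendsto (fun x => ∑' n : ℤ, exp (-π * (n * (n + 2 * a)) * x)) atTop
      (𝓝 (∑' n : ℤ, if n = 0 then 1 else 0)) := by
    refine tendsto_tsum_of_dominated_convergence (hterm one_pos).summable (fun n => ?_) ?_
    · split_ifs with hn
      · simp [hn]
      · refine tendsto_exp_atBot.comp (tendsto_id.const_mul_atTop_of_neg ?_)
        nlinarith [mul_pos pi_pos (hgap n hn)]
    · filter_upwards [eventually_ge_atTop 1] with x hx n
      rw [norm_of_nonneg (exp_pos _).le, exp_le_exp]
      rcases eq_or_ne n 0 with rfl | hn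
      · simp
      · nlinarith [mul_pos pi_pos (hgap n hn)]
  rw [tsum_ite_eq] at hlim
  refine hlim.congr' ?_
  filter_upwards [eventually_gt_atTop 0] with x hx
  exact (hterm hx).tsum_eq

lemma one_sub_sq_mul_sin_sq_pos {k : ℝ} (hk : k ^ 2 < 1) (θ : ℝ) : 0 < 1 - k ^ 2 * sin θ ^ 2 := by
  nlinarith [sin_sq_le_one θ, sq_nonneg (sin θ), sq_nonneg k]

lemma continuous_ellK_integrand {k : ℝ} (hk : k ^ 2 < 1) :
    Continuous fun θ => 1 / sqrt (1 - k ^ 2 * sin θ ^ 2) :=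
  continuous_const.div (by fun_prop) fun θ => (sqrt_pos.mpr (one_sub_sq_mul_sin_sq_pos hk θ)).ne'

lemma pi_div_two_le_ellK {k : ℝ} (hk : k ^ 2 < 1) : π / 2 ≤ EllK k := by
  have h : ∫ _ in (0 : ℝ)..(π / 2), (1 : ℝ) ≤ EllK k := by
    refine intervalIntegral.integral_mono_on (by positivity) (by simp)
      ((continuous_ellK_integrand hk).intervalIntegrable _ _) fun θ _ => ?_
    rw [one_le_div (sqrt_pos.mpr (one_sub_sq_mul_sin_sq_pos hk θ)), sqrt_le_one]
    nlinarith [mul_nonneg (sq_nonneg k) (sq_nonneg (sin θ))]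
  simpa using h

lemma ellK_le_of_sq_le_half {k : ℝ} (hk : k ^ 2 ≤ 1 / 2) : EllK k ≤ π / 2 * (1 + 2 * k ^ 2) := by
  have hk1 : k ^ 2 < 1 := by linarith
  have h : EllK k ≤ ∫ _ in (0 : ℝ)..(π / 2), (1 + 2 * k ^ 2) := by
    refine intervalIntegral.integral_mono_on (by positivity)
      ((continuous_ellK_integrand hk1).intervalIntegrable _ _) (by simp) fun θ _ => ?_
    have hpos := one_sub_sq_mul_sin_sq_pos hk1 θ
    rw [div_le_iff₀ (sqrt_pos.mpr hpos)]
    have hle : 1 - k ^ 2 ≤ 1 - k ^ 2 * sin θ ^ 2 := by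
      nlinarith [sin_sq_le_one θ, sq_nonneg k]
    have hsq : 1 - k ^ 2 ≤ sqrt (1 - k ^ 2 * sin θ ^ 2) :=
      le_sqrt_of_sq_le (by nlinarith [sq_nonneg k])
    nlinarith [sq_nonneg k]
  rwa [intervalIntegral.integral_const, smul_eq_mul, sub_zero] at h

lemma integral_sin_div_sqrt {k : ℝ} (hk0 : 0 < k) (hk1 : k < 1) :
    ∫ θ in (0 : ℝ)..(π / 2), sin θ / sqrt (1 - k ^ 2 * sin θ ^ 2) =
      1 / k * log ((1 + k) / sqrt (1 - k ^ 2)) := by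
  have hk2 : k ^ 2 < 1 := by nlinarith
  set c := sqrt (1 - k ^ 2) with hc
  have hcpos : 0 < c := sqrt_pos.mpr (by linarith)
  have hcsq : c ^ 2 = 1 - k ^ 2 := sq_sqrt (by linarith)
  have hden (θ : ℝ) := sqrt_pos.mpr (one_sub_sq_mul_sin_sq_pos hk2 θ)
  have hderiv (θ : ℝ) : HasDerivAt (fun θ => -(1 / k) * arsinh (k / c * cos θ))
      (sin θ / sqrt (1 - k ^ 2 * sin θ ^ 2)) θ := by
    have h := (((hasDerivAt_cos θ).const_mul (k / c)).arsinh).const_mul (-(1 / k))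
    refine h.congr_deriv ?_
    have hs : sqrt (1 + (k / c * cos θ) ^ 2) = sqrt (1 - k ^ 2 * sin θ ^ 2) / c := by
      rw [eq_div_iff hcpos.ne', ← sqrt_sq hcpos.le, ← sqrt_mul (by positivity), sqrt_sq hcpos.le]
      congr 1
      field_simp
      rw [hcsq, cos_sq']
      ring
    rw [hs, smul_eq_mul]
    have := hden θ
    field_simp
  have hcont : Continuous fun θ => sin θ / sqrt (1 - k ^ 2 * sin θ ^ 2) :=
    continuous_sin.div (by fun_prop) fun θ => (hden θ).ne'
  rw [intervalIntegral.integral_eq_sub_of_hasDerivAt (fun θ _ => hderiv θ)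
    (hcont.intervalIntegrable _ _)]
  have hs : sqrt (1 + (k / c) ^ 2) = 1 / c := by
    rw [show 1 + (k / c) ^ 2 = (1 / c) ^ 2 by field_simp; linarith, sqrt_sq (by positivity)]
  rw [cos_pi_div_two, cos_zero, mul_zero, mul_one, arsinh_zero, arsinh, hs,
    show k / c + 1 / c = (1 + k) / c by ring]
  ring

lemma integral_cos_div_one_add_sin :
    ∫ θ in (0 : ℝ)..(π / 2), cos θ / (1 + sin θ) = log 2 := by
  have hpos : ∀ θ ∈ Set.uIcc 0 (π / 2), 0 < 1 + sin θ := fun θ hθ => by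
    rw [Set.uIcc_of_le (by positivity)] at hθ
    linarith [sin_nonneg_of_nonneg_of_le_pi hθ.1 (by linarith [hθ.2, pi_pos])]
  rw [intervalIntegral.integral_eq_sub_of_hasDerivAt (f := fun θ => log (1 + sin θ))]
  · norm_num
  · exact fun θ hθ => ((hasDerivAt_sin θ).const_add 1).log (hpos θ hθ).ne'
  · exact ContinuousOn.intervalIntegrable
      (continuousOn_cos.div (by fun_prop) fun θ hθ => (hpos θ hθ).ne')

lemma tendsto_integral_one_sub_sin_div_sqrt :
    Tendsto (fun k : ℝ => ∫ θ in (0 : ℝ)..(π / 2), (1 - sin θ) / sqrt (1 - k ^ 2 * sin θ ^ 2))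
      (𝓝[<] 1) (𝓝 (log 2)) := by
  rw [← integral_cos_div_one_add_sin]
  refine intervalIntegral.tendsto_integral_filter_of_dominated_convergence (fun _ => 1) ?_ ?_
    (by simp) ?_
  · refine Eventually.of_forall fun k => Measurable.aestronglyMeasurable ?_
    fun_prop
  · filter_upwards [Ioo_mem_nhdsLT (show (0 : ℝ) < 1 by norm_num)] with k hk
    refine Eventually.of_forall fun θ hmem => ?_
    rw [Set.uIoc_of_le (by positivity)] at hmem
    have hsin : 0 ≤ sin θ := sin_nonneg_of_nonneg_of_le_pi hmem.1.le (by linarith [hmem.2, pi_pos])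
    have hk2 : k ^ 2 < 1 := by nlinarith [hk.1, hk.2]
    have h1 := sin_le_one θ
    have hden := sqrt_pos.mpr (one_sub_sq_mul_sin_sq_pos hk2 θ)
    rw [norm_of_nonneg (div_nonneg (by linarith) hden.le), div_le_one hden]
    refine le_sqrt_of_sq_le ?_
    nlinarith [mul_nonneg (sub_nonneg.mpr hk2.le) (sq_nonneg (sin θ)),
      mul_nonneg hsin (sub_nonneg.mpr h1)]
  · have hne : ∀ᵐ θ : ℝ, θ ≠ π / 2 := by simp [MeasureTheory.ae_iff]
    filter_upwards [hne] with θ hθ hmem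
    rw [Set.uIoc_of_le (by positivity)] at hmem
    have hcos : 0 < cos θ :=
      cos_pos_of_mem_Ioo ⟨by linarith [hmem.1, pi_pos], lt_of_le_of_ne hmem.2 hθ⟩
    have hsin : 0 ≤ sin θ := sin_nonneg_of_nonneg_of_le_pi hmem.1.le (by linarith [hmem.2, pi_pos])
    have hs : sqrt (1 - 1 ^ 2 * sin θ ^ 2) = cos θ := by
      rw [show 1 - 1 ^ 2 * sin θ ^ 2 = cos θ ^ 2 by rw [cos_sq']; ring, sqrt_sq hcos.le]
    have hval : cos θ / (1 + sin θ) = (1 - sin θ) / sqrt (1 - 1 ^ 2 * sin θ ^ 2) := by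
      rw [hs, div_eq_div_iff (by positivity) hcos.ne']
      nlinarith [sin_sq_add_cos_sq θ]
    rw [hval]
    have hc : ContinuousAt (fun k : ℝ => (1 - sin θ) / sqrt (1 - k ^ 2 * sin θ ^ 2)) 1 :=
      continuousAt_const.div (by fun_prop) (by rw [hs]; exact hcos.ne')
    exact hc.tendsto.mono_left nhdsWithin_le_nhds

lemma ellK_eq_log_add_integral {k : ℝ} (hk0 : 0 < k) (hk1 : k < 1) :
    EllK k = 1 / k * log ((1 + k) / sqrt (1 - k ^ 2)) +
      ∫ θ in (0 : ℝ)..(π / 2), (1 - sin θ) / sqrt (1 - k ^ 2 * sin θ ^ 2) := by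
  have hk2 : k ^ 2 < 1 := by nlinarith
  have hden (θ : ℝ) := (sqrt_pos.mpr (one_sub_sq_mul_sin_sq_pos hk2 θ)).ne'
  rw [← integral_sin_div_sqrt hk0 hk1, ← intervalIntegral.integral_add, EllK]
  · congr 1
    funext θ
    rw [← add_div]
    ring
  · exact (continuous_sin.div (by fun_prop) hden).intervalIntegrable _ _
  · exact ((continuous_const.sub continuous_sin).div (by fun_prop) hden).intervalIntegrable _ _

lemma tendsto_sqrt_one_sub_sq : Tendsto (fun k : ℝ => sqrt (1 - k ^ 2)) (𝓝[<] 1) (𝓝[>] 0) := by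
  refine tendsto_nhdsWithin_iff.mpr ⟨?_, ?_⟩
  · have h : ContinuousAt (fun k : ℝ => sqrt (1 - k ^ 2)) 1 := by fun_prop
    have h' := h.tendsto
    norm_num at h'
    exact h'.mono_left nhdsWithin_le_nhds
  · filter_upwards [Ioo_mem_nhdsLT (show (0 : ℝ) < 1 by norm_num)] with k hk
    exact sqrt_pos.mpr (by nlinarith [hk.1, hk.2])

lemma tendsto_sq_mul_log : Tendsto (fun c : ℝ => c ^ 2 * log c) (𝓝[>] 0) (𝓝 0) := by
  simpa [mul_comm] using tendsto_log_mul_rpow_nhdsGT_zero (show (0 : ℝ) < 2 by norm_num)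

/-- The logarithmic singularity of the complete elliptic integral at modulus one. -/
lemma tendsto_ellK_add_log :
    Tendsto (fun k => EllK k + log (sqrt (1 - k ^ 2) / 4)) (𝓝[<] 1) (𝓝 0) := by
  have hid : Tendsto (fun k : ℝ => k) (𝓝[<] 1) (𝓝 1) := nhdsWithin_le_nhds
  have hcl := tendsto_sq_mul_log.comp tendsto_sqrt_one_sub_sq
  have hc2 := ((continuous_pow 2).tendsto (0 : ℝ)).comp
    (tendsto_nhdsWithin_iff.mp tendsto_sqrt_one_sub_sq).1
  have hlog : Tendsto (fun k : ℝ => log (1 + k)) (𝓝[<] 1) (𝓝 (log (1 + 1))) :=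
    (hid.const_add 1).log (by norm_num)
  have hcoef : Tendsto (fun k : ℝ => 1 / (k * (1 + k))) (𝓝[<] 1) (𝓝 (1 / (1 * (1 + 1)))) :=
    tendsto_const_nhds.div (hid.mul (hid.const_add 1)) (by norm_num)
  have hmain := (((hcoef.mul ((hc2.mul hlog).sub hcl)).add hlog).add
    tendsto_integral_one_sub_sin_div_sqrt).sub_const (log 4)
  have hlim : 1 / (1 * (1 + 1)) * (0 ^ 2 * log (1 + 1) - 0) + log (1 + 1) + log 2 - log 4 = 0 := by
    rw [show (4 : ℝ) = 2 * 2 by norm_num, log_mul (by norm_num) (by norm_num)]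
    norm_num
  rw [hlim] at hmain
  refine hmain.congr' ?_
  filter_upwards [Ioo_mem_nhdsLT (show (0 : ℝ) < 1 by norm_num)] with k ⟨hk0, hk1⟩
  have hcpos : 0 < sqrt (1 - k ^ 2) := sqrt_pos.mpr (by nlinarith)
  have hcsq : sqrt (1 - k ^ 2) ^ 2 = 1 - k ^ 2 := sq_sqrt (by nlinarith)
  rw [ellK_eq_log_add_integral hk0 hk1, log_div (by positivity) hcpos.ne',
    log_div hcpos.ne' (by norm_num)]
  simp only [Function.comp_apply, hcsq]
  field_simp
  ring

lemma tendsto_sq_mul_ellK :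
    Tendsto (fun k => (1 - k ^ 2) * EllK k) (𝓝[<] 1) (𝓝 0) := by
  have hcl := tendsto_sq_mul_log.comp tendsto_sqrt_one_sub_sq
  have hc2 := ((continuous_pow 2).tendsto (0 : ℝ)).comp
    (tendsto_nhdsWithin_iff.mp tendsto_sqrt_one_sub_sq).1
  have hmain := ((hc2.mul tendsto_ellK_add_log).sub hcl).add (hc2.mul_const (log 4))
  norm_num at hmain
  refine hmain.congr' ?_
  filter_upwards [Ioo_mem_nhdsLT (show (0 : ℝ) < 1 by norm_num)] with k ⟨hk0, hk1⟩
  have hcpos : 0 < sqrt (1 - k ^ 2) := sqrt_pos.mpr (by nlinarith)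
  have hcsq : sqrt (1 - k ^ 2) ^ 2 = 1 - k ^ 2 := sq_sqrt (by nlinarith)
  simp only [hcsq]
  rw [log_div hcpos.ne' (by norm_num)]
  ring

/-- The logarithm of the complementary nome is asymptotic to `2 log (k' / 4)` with vanishing
error. -/
lemma tendsto_log_complementary_nome :
    Tendsto (fun k => π * (EllK k / EllK' k) + 2 * log (sqrt (1 - k ^ 2) / 4)) (𝓝[<] 1) (𝓝 0) := by
  have hsmall : Tendsto (fun k => π * (EllK k / EllK' k) - 2 * EllK k) (𝓝[<] 1) (𝓝 0) := by
    refine squeeze_zero_norm' ?_ (by simpa using tendsto_sq_mul_ellK.const_mul 4)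
    have hc := tendsto_sqrt_one_sub_sq.eventually (Ioo_mem_nhdsGT (show (0 : ℝ) < 1 / 2 by norm_num))
    filter_upwards [Ioo_mem_nhdsLT (show (0 : ℝ) < 1 by norm_num), hc] with k ⟨hk0, hk1⟩ ⟨hc0, hc1⟩
    have hcsq : sqrt (1 - k ^ 2) ^ 2 = 1 - k ^ 2 := sq_sqrt (by nlinarith)
    have hlow : π / 2 ≤ EllK' k := pi_div_two_le_ellK (by nlinarith)
    have hup : EllK' k ≤ π / 2 * (1 + 2 * (1 - k ^ 2)) := by
      rw [← hcsq]
      exact ellK_le_of_sq_le_half (by nlinarith)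
    have hK : 0 < EllK k := by linarith [pi_div_two_le_ellK (show k ^ 2 < 1 by nlinarith), pi_pos]
    have hK' : 0 < EllK' k := by linarith [pi_pos]
    have hx : 0 < 1 - k ^ 2 := by nlinarith
    rw [show π * (EllK k / EllK' k) - 2 * EllK k =
      -((2 * EllK' k - π) / EllK' k * EllK k) by field_simp; ring, norm_neg,
      norm_of_nonneg (by have : 0 ≤ 2 * EllK' k - π := by linarith
                         positivity), ← mul_assoc]
    refine mul_le_mul_of_nonneg_right ?_ hK.le
    rw [div_le_iff₀ hK']
    nlinarith
  have h := hsmall.add (tendsto_ellK_add_log.const_mul 2)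
  norm_num at h
  refine h.congr fun k => ?_
  ring

/-- Jacobi's imaginary transformation for `sn`, in terms of the even Hurwitz kernel. -/
lemma sn_eq_evenKernel (lam : ℝ) {k : ℝ} (hK : 0 < EllK k) (hK' : 0 < EllK' k) :
    sn (lam * EllK k) k =
      (evenKernel ((1 - lam) / 4 : ℝ) (4 * (EllK k / EllK' k)) -
        evenKernel ((1 + lam) / 4 : ℝ) (4 * (EllK k / EllK' k))) /
      (sqrt k * (evenKernel ((1 - lam) / 4 : ℝ) (4 * (EllK k / EllK' k)) +
        evenKernel ((1 + lam) / 4 : ℝ) (4 * (EllK k / EllK' k)))) := by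
  have ht : 0 < EllK' k / EllK k := div_pos hK' hK
  have hq : nome k = exp (-π * (EllK' k / EllK k)) := by rw [nome, mul_div_assoc]
  have hH : JH (lam * EllK k) k = (cosKernel ((1 - lam) / 4 : ℝ) (EllK' k / EllK k / 4) -
      cosKernel ((1 + lam) / 4 : ℝ) (EllK' k / EllK k / 4)) / 2 := by
    rw [← (hasSum_alternating_sin_theta lam ht).tsum_eq, tsum_mul_left, JH, hq]
    congr 2
    funext n
    congr 2
    field_simp
  have hT : JTheta (lam * EllK k) k = (cosKernel ((1 - lam) / 4 : ℝ) (EllK' k / EllK k / 4) +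
      cosKernel ((1 + lam) / 4 : ℝ) (EllK' k / EllK k / 4)) / 2 := by
    rw [← add_sub_cancel 1 ((_ + _) / 2), ← (hasSum_alternating_cos_theta lam ht).tsum_eq,
      tsum_mul_left, JTheta, hq]
    congr 3
    funext n
    congr 2
    field_simp
  have hx : 4 / (EllK' k / EllK k) = 4 * (EllK k / EllK' k) := by field_simp
  have hpos : 0 < (1 / (EllK' k / EllK k)) ^ (1 / 2 : ℝ) := by positivity
  rw [sn, hH, hT, cosKernel_eq_evenKernel _ ht, cosKernel_eq_evenKernel _ ht, hx,
    ← mul_sub, ← mul_add, mul_assoc 2, mul_assoc 2, mul_div_cancel_left₀ _ two_ne_zero,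
    mul_div_cancel_left₀ _ two_ne_zero, mul_left_comm]
  exact mul_div_mul_left _ _ hpos.ne'

lemma tendsto_ellK_div_ellK' : Tendsto (fun k => EllK k / EllK' k) (𝓝[<] 1) atTop := by
  have hc : Tendsto (fun k : ℝ => -(2 * log (sqrt (1 - k ^ 2) / 4))) (𝓝[<] 1) atTop := by
    refine tendsto_neg_atBot_atTop.comp (Tendsto.const_mul_atBot (by norm_num) ?_)
    refine (tendsto_atBot_add_const_right _ (-log 4)
      (tendsto_log_nhdsGT_zero.comp tendsto_sqrt_one_sub_sq)).congr' ?_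
    filter_upwards [tendsto_sqrt_one_sub_sq.eventually self_mem_nhdsWithin] with k hk
    rw [log_div hk.ne' (by norm_num)]
    rfl
  have h := (tendsto_log_complementary_nome.add_atTop hc).const_mul_atTop
    (inv_pos.mpr pi_pos)
  refine h.congr fun k => ?_
  field_simp
  ring

/-- The ratio of the two kernels is asymptotic to `exp (-π λ x)`. -/
lemma tendsto_evenKernel_ratio {lam : ℝ} (hlam : 0 < lam) (hlam' : lam < 1) :
    Tendsto (fun x => evenKernel ((1 + lam) / 4 : ℝ) (4 * x) /
      evenKernel ((1 - lam) / 4 : ℝ) (4 * x) * exp (π * lam * x)) atTop (𝓝 1) := by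
  have h4 : Tendsto (fun x : ℝ => 4 * x) atTop atTop :=
    tendsto_id.const_mul_atTop (by norm_num)
  have ha := (tendsto_evenKernel_mul_exp (a := (1 - lam) / 4)
    (abs_lt.mpr ⟨by linarith, by linarith⟩)).comp h4
  have hb := (tendsto_evenKernel_mul_exp (a := (1 + lam) / 4)
    (abs_lt.mpr ⟨by linarith, by linarith⟩)).comp h4
  have h := hb.div ha one_ne_zero
  rw [div_one] at h
  refine h.congr fun x => ?_
  simp only [Pi.div_apply, Function.comp_apply]
  rw [mul_div_mul_comm, ← exp_sub]
  ring_nf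

theorem stmt_10 (lam : ℝ) (hlam : 0 < lam) (hlam' : lam < 1) :
    Filter.Tendsto (fun k : ℝ =>
        (1 - sn (lam * EllK k) k) / (2 * (Real.sqrt (1 - k^2) / 4) ^ (2 * lam)))
      (nhdsWithin 1 (Set.Iio (1:ℝ))) (nhds 1) := by
  set R : ℝ → ℝ := fun k => evenKernel ((1 + lam) / 4 : ℝ) (4 * (EllK k / EllK' k)) /
    evenKernel ((1 - lam) / 4 : ℝ) (4 * (EllK k / EllK' k)) with hR
  set D : ℝ → ℝ := fun k => (sqrt (1 - k ^ 2) / 4) ^ (2 * lam) with hD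
  have hIoo := Ioo_mem_nhdsLT (show (0 : ℝ) < 1 by norm_num)
  have hRD : Tendsto (fun k => R k / D k) (𝓝[<] 1) (𝓝 1) := by
    have hexp := (continuous_exp.tendsto _).comp (tendsto_log_complementary_nome.const_mul (-lam))
    have h := ((tendsto_evenKernel_ratio hlam hlam').comp tendsto_ellK_div_ellK').mul hexp
    rw [mul_zero, exp_zero, one_mul] at h
    refine h.congr' ?_
    filter_upwards [tendsto_sqrt_one_sub_sq.eventually self_mem_nhdsWithin] with k hk
    have hk : 0 < sqrt (1 - k ^ 2) := hk
    simp only [Function.comp_apply, hR, hD]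
    rw [rpow_def_of_pos (by positivity), mul_assoc, ← exp_add, div_eq_mul_inv _ (exp _), ← exp_neg]
    ring_nf
  have hc : Tendsto (fun k : ℝ => sqrt (1 - k ^ 2) / 4) (𝓝[<] 1) (𝓝 0) := by
    simpa using (tendsto_nhdsWithin_iff.mp tendsto_sqrt_one_sub_sq).1.div_const 4
  have hrpow {s : ℝ} (hs : 0 < s) :
      Tendsto (fun k : ℝ => (sqrt (1 - k ^ 2) / 4) ^ s) (𝓝[<] 1) (𝓝 0) := by
    simpa [zero_rpow hs.ne'] using hc.rpow_const (p := s) (Or.inr hs.le)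
  have hDpos : ∀ᶠ k in 𝓝[<] 1, 0 < D k := by
    filter_upwards [tendsto_sqrt_one_sub_sq.eventually self_mem_nhdsWithin] with k hk
    have hk : 0 < sqrt (1 - k ^ 2) := hk
    positivity
  have hR0 : Tendsto R (𝓝[<] 1) (𝓝 0) := by
    have h := hRD.mul (hrpow (show 0 < 2 * lam by linarith))
    rw [mul_zero] at h
    refine h.congr' ?_
    filter_upwards [hDpos] with k hk
    exact div_mul_cancel₀ _ hk.ne'
  have hsqrt : Tendsto (fun k => (sqrt k - 1) / (2 * D k)) (𝓝[<] 1) (𝓝 0) := by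
    refine squeeze_zero_norm' ?_
      (by simpa using (hrpow (show 0 < 2 - 2 * lam by linarith)).const_mul 8)
    filter_upwards [hIoo, hDpos, tendsto_sqrt_one_sub_sq.eventually self_mem_nhdsWithin]
      with k ⟨hk0, hk1⟩ hDk hck
    have hck : 0 < sqrt (1 - k ^ 2) := hck
    have hcsq : sqrt (1 - k ^ 2) ^ 2 = 1 - k ^ 2 := sq_sqrt (by nlinarith)
    have hs1 : sqrt k ≤ 1 := sqrt_le_one.mpr hk1.le
    have hs2 : k ≤ sqrt k := le_sqrt_of_sq_le (by nlinarith)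
    rw [norm_div, norm_of_nonneg (by positivity : 0 ≤ 2 * D k), norm_of_nonpos (by linarith),
      div_le_iff₀ (by positivity)]
    have hprod : (sqrt (1 - k ^ 2) / 4) ^ (2 - 2 * lam) * D k = (1 - k ^ 2) / 16 := by
      rw [hD, ← rpow_add (by positivity), sub_add_cancel, rpow_two, div_pow, hcsq]
      norm_num
    nlinarith
  have hk : Tendsto (fun k : ℝ => sqrt k) (𝓝[<] 1) (𝓝 1) := by
    simpa using (continuous_sqrt.tendsto 1).mono_left nhdsWithin_le_nhds
  have hmain := (hsqrt.add (hRD.div (hR0.const_add 1) (by norm_num))).div hk one_ne_zero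
  norm_num at hmain
  refine hmain.congr' ?_
  filter_upwards [hIoo, hDpos, tendsto_ellK_div_ellK'.eventually_gt_atTop 0] with k ⟨hk0, hk1⟩ hDk hx
  have hK : 0 < EllK k := by linarith [pi_div_two_le_ellK (show k ^ 2 < 1 by nlinarith), pi_pos]
  have hK' : 0 < EllK' k := (div_pos_iff_of_pos_left hK).mp hx
  have hA := evenKernel_pos ((1 - lam) / 4) (show 0 < 4 * (EllK k / EllK' k) by positivity)
  have hB := evenKernel_pos ((1 + lam) / 4) (show 0 < 4 * (EllK k / EllK' k) by positivity)
  have hsk := sqrt_pos.mpr hk0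
  change _ = (1 - sn (lam * EllK k) k) / (2 * D k)
  rw [sn_eq_evenKernel lam hK hK']
  simp only [Pi.div_apply, hR]
  generalize evenKernel ((1 - lam) / 4 : ℝ) (4 * (EllK k / EllK' k)) = A at *
  generalize evenKernel ((1 + lam) / 4 : ℝ) (4 * (EllK k / EllK' k)) = B at *
  generalize D k = d at *
  field_simp
  ring
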